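/- arXiv:2301.12737 — 2 statements merged into one kernel-verified Lean document; each statement's English description precedes it below -/
import Mathlib

section
/- Fix a real N>0 and 0<δ<1. For every y>0: ∫_{−Nπ}^{Nπ} (S^{N,δ}(x+iy) − (x+iy)) dx = −2πiN²·log(1−δ²). (Lemma: exact value of the average displacement of the cylindrical slit map, computed by contour integration.) -/
open Complex Filter

/-- The map `f_N(z) = exp(-iz/N)` from the cylinder to the complement of the unit disk. -/
noncomputable def fN (N : ℝ) (z : ℂ) : ℂ := Complex.exp (-Complex.I * z / N)

/-- The inverse map `f_N⁻¹(w) = iN·Log w` (principal branch). -/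
noncomputable def fNinv (N : ℝ) (w : ℂ) : ℂ := Complex.I * N * Complex.log w

/-- The Möbius map `g(z) = i(z-1)/(z+1)`. -/
noncomputable def gMap (z : ℂ) : ℂ := Complex.I * (z - 1) / (z + 1)

/-- The inverse Möbius map `g⁻¹(w) = (i+w)/(i-w)`. -/
noncomputable def gInv (w : ℂ) : ℂ := (Complex.I + w) / (Complex.I - w)

/-- The half-plane slit map `φ^δ(z) = z·(1-δ²-δ²/z²)^{1/2}` (principal square root). -/
noncomputable def phiSlit (δ : ℝ) (z : ℂ) : ℂ :=
  z * (1 - (δ:ℂ)^2 - (δ:ℂ)^2 / z^2) ^ ((1:ℂ)/2)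

/-- The cylindrical slit map `S^{N,δ} = f_N⁻¹∘g⁻¹∘φ^δ∘g∘f_N`. -/
noncomputable def cylSlit (N δ : ℝ) (z : ℂ) : ℂ :=
  fNinv N (gInv (phiSlit δ (gMap (fN N z))))

/-- The slit-size parameter `δ(N,λ) = 1 - 2/(1+e^{λ/N})`. -/
noncomputable def deltaN (N lam : ℝ) : ℝ := 1 - 2 / (1 + Real.exp (lam / N))



/-- The slit map factor `1 - δ² - δ²/ζ²` avoids the branch cut on the upper half-plane. -/
lemma one_sub_sq_sub_div_sq_mem_slitPlane {δ : ℝ} (hδ : 0 < δ) (hδ1 : δ < 1) {ζ : ℂ}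
    (hζ : 0 < ζ.im) : 1 - (δ : ℂ) ^ 2 - (δ : ℂ) ^ 2 / ζ ^ 2 ∈ slitPlane := by
  have hζ0 : ζ ≠ 0 := by rintro rfl; simp at hζ
  set m := 1 - (δ : ℂ) ^ 2 - (δ : ℂ) ^ 2 / ζ ^ 2 with hm
  have hmζ : m * ζ ^ 2 = (1 - (δ : ℂ) ^ 2) * ζ ^ 2 - (δ : ℂ) ^ 2 := by
    rw [hm]; field_simp
  rw [mem_slitPlane_iff]
  by_contra! h
  obtain ⟨hre, him⟩ := h
  have h1 := congrArg re hmζ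
  have h2 := congrArg im hmζ
  simp [pow_two, him] at h1 h2
  have hab : ζ.re = 0 := by
    rcases h2 with h2 | h2
    · nlinarith
    · have : ζ.re * ζ.im = 0 := by linarith
      exact (mul_eq_zero.1 this).resolve_right hζ.ne'
  rw [hab] at h1
  have : 0 < ζ.im * ζ.im * (1 - δ * δ - m.re) := by
    apply mul_pos (mul_pos hζ hζ); nlinarith
  nlinarith

lemma phiSlit_sq {ζ : ℂ} (δ : ℝ) (hζ : ζ ≠ 0) :
    phiSlit δ ζ ^ 2 = ζ ^ 2 * (1 - (δ : ℂ) ^ 2) - (δ : ℂ) ^ 2 := by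
  have : ((1 - (δ : ℂ) ^ 2 - (δ : ℂ) ^ 2 / ζ ^ 2) ^ ((1 : ℂ) / 2)) ^ 2
      = 1 - (δ : ℂ) ^ 2 - (δ : ℂ) ^ 2 / ζ ^ 2 := by
    simp
  rw [phiSlit, mul_pow, this]
  field_simp

/-- The principal square root of a point of the slit plane has positive real part. -/
lemma re_cpow_half_pos {m : ℂ} (hm : m ∈ slitPlane) : 0 < (m ^ ((1 : ℂ) / 2)).re := by
  have h0 : m ≠ 0 := slitPlane_ne_zero hm
  rw [cpow_def_of_ne_zero h0, exp_re]
  have h1 : (log m * (1 / 2)).im = arg m / 2 := by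
    simp [log_im]; ring
  have h2 := neg_pi_lt_arg m
  have h3 : arg m < Real.pi := lt_of_le_of_ne (arg_le_pi m) (mem_slitPlane_iff_arg.1 hm).1
  rw [h1]
  exact mul_pos (Real.exp_pos _) (Real.cos_pos_of_mem_Ioo ⟨by linarith, by linarith⟩)

/-- The slit map preserves the upper half-plane. -/
lemma im_phiSlit_pos {δ : ℝ} (hδ : 0 < δ) (hδ1 : δ < 1) {ζ : ℂ} (hζ : 0 < ζ.im) :
    0 < (phiSlit δ ζ).im := by
  have hζ0 : ζ ≠ 0 := by rintro rfl; simp at hζ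
  have hr := re_cpow_half_pos (one_sub_sq_sub_div_sq_mem_slitPlane hδ hδ1 hζ)
  have hsq := phiSlit_sq δ hζ0
  rw [phiSlit] at hsq ⊢
  set r := (1 - (δ : ℂ) ^ 2 - (δ : ℂ) ^ 2 / ζ ^ 2) ^ ((1 : ℂ) / 2)
  have h1 := congrArg re hsq
  have h2 := congrArg im hsq
  simp [pow_two] at h1 h2
  have key : r.re * (ζ.re * r.im) * (ζ.re ^ 2 + ζ.im ^ 2) ^ 2 = δ ^ 2 * ζ.re ^ 2 * ζ.im := by
    linear_combination (ζ.re * (ζ.re ^ 2 - ζ.im ^ 2) / 2) * h2 - ζ.re ^ 2 * ζ.im * h1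
  have hD : 0 < (ζ.re ^ 2 + ζ.im ^ 2) ^ 2 := by positivity
  have : 0 ≤ ζ.re * r.im := by
    by_contra! hneg
    have : r.re * (ζ.re * r.im) * (ζ.re ^ 2 + ζ.im ^ 2) ^ 2 < 0 :=
      mul_neg_of_neg_of_pos (mul_neg_of_pos_of_neg hr hneg) hD
    rw [key] at this
    exact absurd this (not_lt.2 (by positivity))
  rw [mul_im]
  nlinarith [mul_pos hζ hr]

/-- The slit map preserves the sign of the real part. -/
lemma re_phiSlit_mul_im {δ : ℝ} {ζ : ℂ} (hζ : ζ ≠ 0) :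
    (phiSlit δ ζ).re * (phiSlit δ ζ).im = ζ.re * ζ.im * (1 - δ ^ 2) := by
  have h2 := congrArg im (phiSlit_sq δ hζ)
  simp [pow_two] at h2
  linarith

lemma re_I_mul_div (v : ℂ) : (I * (1 - v) / (1 + v)).re = 2 * v.im / normSq (1 + v) := by
  rw [div_re]; simp; ring

lemma im_I_mul_div (v : ℂ) :
    (I * (1 - v) / (1 + v)).im = (1 - normSq v) / normSq (1 + v) := by
  rw [div_im]; simp [normSq_apply v]; ring

/-- The Möbius map sends the punctured disk, in the coordinate `v = 1/w`, to the half-plane. -/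
lemma gMap_inv {v : ℂ} (hv : v ≠ 0) : gMap v⁻¹ = I * (1 - v) / (1 + v) := by
  rw [gMap, ← mul_div_mul_right _ _ hv]
  congr 1 <;> field_simp

lemma one_add_ne_zero_of_norm_lt_one {v : ℂ} (hv : ‖v‖ < 1) : 1 + v ≠ 0 := by
  intro h
  have : v = -1 := by linear_combination h
  simp [this] at hv

lemma im_I_mul_div_pos {v : ℂ} (hv : ‖v‖ < 1) : 0 < (I * (1 - v) / (1 + v)).im := by
  rw [im_I_mul_div]
  refine div_pos ?_ (normSq_pos.2 (one_add_ne_zero_of_norm_lt_one hv))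
  rw [normSq_eq_norm_sq]
  nlinarith [norm_nonneg v]

/-- In the coordinate `v = 1/w` near infinity, the quotient `W/w`, where `W` is the image of `w`
under the slit map conjugated to the exterior disk. -/
noncomputable def slitQuot (δ : ℝ) (v : ℂ) : ℂ :=
  (1 - I * phiSlit δ (I * (1 - v) / (1 + v))) ^ 2 * (1 + v) ^ 2 / (4 * (1 - (δ : ℂ) ^ 2))

lemma one_sub_ofReal_sq_ne_zero {δ : ℝ} (hδ : 0 < δ) (hδ1 : δ < 1) : 1 - (δ : ℂ) ^ 2 ≠ 0 := by
  have : (1 - δ ^ 2 : ℝ) ≠ 0 := by nlinarith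
  exact_mod_cast this

/-- In the coordinate `v = 1/w`, the slit map takes the value `i` only at `v = 0`. -/
lemma I_sub_phiSlit_ne_zero {δ : ℝ} (hδ : 0 < δ) (hδ1 : δ < 1) {v : ℂ} (hv : ‖v‖ < 1)
    (hv0 : v ≠ 0) : I - phiSlit δ (I * (1 - v) / (1 + v)) ≠ 0 := by
  have h1 := one_add_ne_zero_of_norm_lt_one hv
  have hζ := im_I_mul_div_pos hv
  have hζ0 : I * (1 - v) / (1 + v) ≠ 0 := by intro h; simp [h] at hζ
  have hsq := phiSlit_sq δ hζ0
  have hd := one_sub_ofReal_sq_ne_zero hδ hδ1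
  intro h
  rw [← sub_eq_zero.1 h, I_sq, div_pow, mul_pow, I_sq] at hsq
  field_simp at hsq
  have : 4 * v * (1 - (δ : ℂ) ^ 2) = 0 := by linear_combination -hsq
  simp_all

lemma mul_gInv_eq_slitQuot {δ : ℝ} (hδ : 0 < δ) (hδ1 : δ < 1) {v : ℂ} (hv : ‖v‖ < 1)
    (hv0 : v ≠ 0) : v * gInv (phiSlit δ (gMap v⁻¹)) = slitQuot δ v := by
  have h1 := one_add_ne_zero_of_norm_lt_one hv
  have hζ := im_I_mul_div_pos hv
  have hζ0 : I * (1 - v) / (1 + v) ≠ 0 := by intro h; simp [h] at hζ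
  have hsq := phiSlit_sq δ hζ0
  have hd := one_sub_ofReal_sq_ne_zero hδ hδ1
  have hI := I_sub_phiSlit_ne_zero hδ hδ1 hv hv0
  rw [gMap_inv hv0, gInv, slitQuot]
  set u := phiSlit δ (I * (1 - v) / (1 + v))
  rw [div_pow, mul_pow, I_sq] at hsq
  have hsq' : u ^ 2 * (1 + v) ^ 2
      = -(1 - v) ^ 2 * (1 - (δ : ℂ) ^ 2) - (δ : ℂ) ^ 2 * (1 + v) ^ 2 := by
    rw [hsq]; field_simp
  rw [← mul_div_assoc, div_eq_div_iff hI (by simpa using hd)]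
  have e : (1 - I * u) ^ 2 = -(I + u) ^ 2 := by
    linear_combination (1 + u ^ 2) * I_sq
  rw [e]
  linear_combination -(I + u) * hsq' + (I + u) * (1 + v) ^ 2 * I_sq

/-- The image of a nonreal point under the conjugated slit map stays in the same half-plane. -/
lemma im_gInv_mul_im_neg {δ : ℝ} (hδ : 0 < δ) (hδ1 : δ < 1) {v : ℂ} (hv : ‖v‖ < 1)
    (hv0 : v.im ≠ 0) : (gInv (phiSlit δ (gMap v⁻¹))).im * v.im < 0 := by
  have hv1 : v ≠ 0 := by rintro rfl; simp at hv0
  have h1 := one_add_ne_zero_of_norm_lt_one hv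
  have hζ := im_I_mul_div_pos hv
  have hζ0 : I * (1 - v) / (1 + v) ≠ 0 := by intro h; simp [h] at hζ
  have hI := I_sub_phiSlit_ne_zero hδ hδ1 hv hv1
  have hu := im_phiSlit_pos hδ hδ1 hζ
  have hre := re_phiSlit_mul_im (δ := δ) hζ0
  rw [re_I_mul_div] at hre
  rw [gMap_inv hv1, gInv]
  set u := phiSlit δ (I * (1 - v) / (1 + v))
  set b := (I * (1 - v) / (1 + v)).im
  have hN := normSq_pos.2 hI
  have hN' := normSq_pos.2 h1
  have hW : ((I + u) / (I - u)).im = -2 * u.re / normSq (I - u) := by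
    rw [div_im]; simp; ring
  rw [hW, div_mul_eq_mul_div]
  refine div_neg_of_neg_of_pos ?_ hN
  have : 0 < u.re * v.im * u.im := by
    have : u.re * v.im * u.im = 2 * v.im ^ 2 / normSq (1 + v) * b * (1 - δ ^ 2) := by
      linear_combination v.im * hre
    rw [this]
    have : 0 < 1 - δ ^ 2 := by nlinarith
    positivity
  have := pos_of_mul_pos_left this hu.le
  linarith

lemma slitQuot_mem_slitPlane {δ : ℝ} (hδ : 0 < δ) (hδ1 : δ < 1) {v : ℂ} (hv : ‖v‖ < 1) :
    slitQuot δ v ∈ slitPlane := by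
  rw [mem_slitPlane_iff]
  by_cases hvim : v.im = 0
  · left
    have h1 := one_add_ne_zero_of_norm_lt_one hv
    have hζ := im_I_mul_div_pos hv
    have hζ0 : I * (1 - v) / (1 + v) ≠ 0 := by intro h; simp [h] at hζ
    have hu := im_phiSlit_pos hδ hδ1 hζ
    have hre := re_phiSlit_mul_im (δ := δ) hζ0
    rw [re_I_mul_div, hvim] at hre
    rw [slitQuot]
    set u := phiSlit δ (I * (1 - v) / (1 + v))
    have hu0 : u.re = 0 := by
      have : u.re * u.im = 0 := by simpa using hre
      exact (mul_eq_zero.1 this).resolve_right hu.ne'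
    obtain ⟨a, rfl⟩ : ∃ a : ℝ, v = a := ⟨v.re, Complex.ext rfl (by simpa using hvim)⟩
    have e1 : 1 - I * u = ((1 + u.im : ℝ) : ℂ) := by
      apply Complex.ext <;> simp [hu0]
    have e2 : (1 - I * u) ^ 2 * (1 + (a : ℂ)) ^ 2 / (4 * (1 - (δ : ℂ) ^ 2))
        = (((1 + u.im) ^ 2 * (1 + a) ^ 2 / (4 * (1 - δ ^ 2)) : ℝ) : ℂ) := by
      rw [e1]; push_cast; rfl
    rw [e2, ofReal_re]
    have h3 : (1 + a) ≠ 0 := by exact_mod_cast h1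
    have : 0 < 1 - δ ^ 2 := by nlinarith
    positivity
  · have hv0 : v ≠ 0 := by rintro rfl; simp at hvim
    have hneg := im_gInv_mul_im_neg hδ hδ1 hv hvim
    rw [← mul_gInv_eq_slitQuot hδ hδ1 hv hv0]
    set W := gInv (phiSlit δ (gMap v⁻¹))
    by_contra! h
    obtain ⟨hre, him⟩ := h
    rw [mul_re] at hre
    rw [mul_im] at him
    have : (v.re * W.re - v.im * W.im) * v.im ^ 2 = (-(W.im * v.im)) * (v.re ^ 2 + v.im ^ 2) := by
      linear_combination v.re * v.im * him
    have h2 : 0 < (-(W.im * v.im)) * (v.re ^ 2 + v.im ^ 2) := by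
      apply mul_pos (by linarith); positivity
    have h3 : 0 ≤ v.im ^ 2 := by positivity
    nlinarith

lemma log_gInv_eq {δ : ℝ} (hδ : 0 < δ) (hδ1 : δ < 1) {v : ℂ} (hv : ‖v‖ < 1)
    (hvim : v.im ≠ 0) :
    log (gInv (phiSlit δ (gMap v⁻¹))) = log (slitQuot δ v) - log v := by
  have hv0 : v ≠ 0 := by rintro rfl; simp at hvim
  have hneg := im_gInv_mul_im_neg hδ hδ1 hv hvim
  rw [← mul_gInv_eq_slitQuot hδ hδ1 hv hv0]
  set W := gInv (phiSlit δ (gMap v⁻¹))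
  have hW0 : W ≠ 0 := by intro h; simp [h] at hneg
  rw [log_mul hv0 hW0]
  · ring
  have a1 := neg_pi_lt_arg v
  have a2 := arg_le_pi v
  have a3 := neg_pi_lt_arg W
  have a4 := arg_le_pi W
  rcases lt_or_gt_of_ne hvim with h | h
  · have hW : 0 ≤ W.im := by nlinarith
    have := arg_neg_iff.2 h
    have := arg_nonneg_iff.2 hW
    constructor <;> linarith
  · have hW : W.im < 0 := by nlinarith
    have := arg_neg_iff.2 hW
    have := arg_nonneg_iff.2 h.le
    constructor <;> linarith

lemma differentiableAt_slitQuot {δ : ℝ} (hδ : 0 < δ) (hδ1 : δ < 1) {v : ℂ} (hv : ‖v‖ < 1) :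
    DifferentiableAt ℂ (slitQuot δ) v := by
  have h1 := one_add_ne_zero_of_norm_lt_one hv
  have hζ := im_I_mul_div_pos hv
  have hζ0 : I * (1 - v) / (1 + v) ≠ 0 := by intro h; simp [h] at hζ
  have hg : DifferentiableAt ℂ (fun v : ℂ => I * (1 - v) / (1 + v)) v := by
    fun_prop (disch := assumption)
  have hφ : DifferentiableAt ℂ (phiSlit δ) (I * (1 - v) / (1 + v)) := by
    unfold phiSlit
    refine differentiableAt_id.mul (DifferentiableAt.cpow ?_ (by fun_prop)
      (one_sub_sq_sub_div_sq_mem_slitPlane hδ hδ1 hζ))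
    fun_prop (disch := simpa using hζ0)
  have hcomp : DifferentiableAt ℂ (fun v : ℂ => phiSlit δ (I * (1 - v) / (1 + v))) v :=
    DifferentiableAt.comp (g := phiSlit δ) v hφ hg
  unfold slitQuot
  fun_prop

lemma slitQuot_zero {δ : ℝ} (hδ : 0 < δ) (hδ1 : δ < 1) :
    slitQuot δ 0 = ((1 - δ ^ 2)⁻¹ : ℝ) := by
  have hd := one_sub_ofReal_sq_ne_zero hδ hδ1
  have h : phiSlit δ I = I := by simp [phiSlit, div_neg]
  simp only [slitQuot, sub_zero, add_zero, mul_one, div_one, h, I_mul_I]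
  push_cast
  field_simp
  norm_num

lemma circleAverage_log_slitQuot {δ : ℝ} (hδ : 0 < δ) (hδ1 : δ < 1) {R : ℝ} (hR : 0 < R)
    (hR1 : R < 1) :
    Real.circleAverage (fun v => log (slitQuot δ v)) 0 R = -Real.log (1 - δ ^ 2) := by
  have hd : ∀ v ∈ Metric.closedBall (0 : ℂ) |R|,
      DifferentiableAt ℂ (fun v => log (slitQuot δ v)) v := by
    intro v hv
    have hv1 : ‖v‖ < 1 := by
      rw [abs_of_pos hR, mem_closedBall_zero_iff] at hv
      linarith
    exact (differentiableAt_slitQuot hδ hδ1 hv1).clog (slitQuot_mem_slitPlane hδ hδ1 hv1)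
  rw [circleAverage_of_differentiable_on_off_countable Set.countable_empty
    (fun v hv => (hd v hv).continuousAt.continuousWithinAt)
    (fun v hv => hd v (Metric.ball_subset_closedBall hv.1)), slitQuot_zero hδ hδ1,
    ← ofReal_log (inv_nonneg.2 (by nlinarith)), Real.log_inv]
  push_cast
  rfl

/-- The displacement of the cylindrical slit map in terms of `slitQuot`. -/
lemma cylSlit_sub_self {N δ : ℝ} (hN : 0 < N) (hδ : 0 < δ) (hδ1 : δ < 1) {x y : ℝ} (hy : 0 < y)
    (hx : x ∈ Set.Ioo (-(N * Real.pi)) (N * Real.pi)) (hx0 : x ≠ 0) :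
    cylSlit N δ (x + y * I) - (x + y * I)
      = I * N * log (slitQuot δ (circleMap 0 (Real.exp (-y / N)) (x / N))) := by
  have hNC : (N : ℂ) ≠ 0 := by exact_mod_cast hN.ne'
  set v := circleMap 0 (Real.exp (-y / N)) (x / N) with hvdef
  have hve : v = exp (I * (x + y * I) / N) := by
    rw [hvdef, circleMap_zero, ofReal_exp, ← Complex.exp_add]
    congr 1
    push_cast
    field_simp
    linear_combination (-(y : ℂ)) * I_sq
  have hv : ‖v‖ < 1 := by
    rw [hvdef, norm_circleMap_zero, abs_of_pos (Real.exp_pos _), Real.exp_lt_one_iff]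
    exact div_neg_of_neg_of_pos (by linarith) hN
  have hxl : -Real.pi < x / N := by rw [lt_div_iff₀ hN]; linarith [hx.1]
  have hxr : x / N < Real.pi := by rw [div_lt_iff₀ hN]; linarith [hx.2]
  have hlog : log v = I * (x + y * I) / N := by
    have : (I * (x + y * I) / N).im = x / N := by
      rw [div_ofReal_im]; simp
    rw [hve, log_exp (by rw [this]; exact hxl) (by rw [this]; exact hxr.le)]
  have hvim : v.im ≠ 0 := by
    have h1 : v.im = Real.exp (-y / N) * Real.sin (x / N) := by
      rw [hvdef, circleMap_zero, im_ofReal_mul, exp_ofReal_mul_I_im]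
    rw [h1]
    refine mul_ne_zero (Real.exp_pos _).ne' fun h => ?_
    exact div_ne_zero hx0 hN.ne' ((Real.sin_eq_zero_iff_of_lt_of_lt hxl hxr).1 h)
  have hf : fN N (x + y * I) = v⁻¹ := by
    rw [hve, ← Complex.exp_neg, fN]
    congr 1
    ring
  rw [cylSlit, hf, fNinv, log_gInv_eq hδ hδ1 hv hvim, hlog]
  field_simp
  linear_combination (-(x + y * I : ℂ)) * I_sq

/-- Exact value of the average displacement of the cylindrical slit map. -/
theorem integral_displacement_eq (N δ : ℝ) (hN : 0 < N) (hδ : 0 < δ) (hδ1 : δ < 1)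
    (y : ℝ) (hy : 0 < y) :
    (∫ x : ℝ in (-(N * Real.pi))..(N * Real.pi),
        (cylSlit N δ (x + y * Complex.I) - (x + y * Complex.I)))
      = -2 * Real.pi * Complex.I * (N:ℂ)^2 * Real.log (1 - δ^2) := by
  have hNpi : -(N * Real.pi) ≤ N * Real.pi := by nlinarith [Real.pi_pos]
  set R := Real.exp (-y / N) with hR
  set F : ℝ → ℂ := fun θ => log (slitQuot δ (circleMap 0 R θ)) with hF
  have hcongr : (∫ x : ℝ in (-(N * Real.pi))..(N * Real.pi),
        (cylSlit N δ (x + y * Complex.I) - (x + y * Complex.I)))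
      = ∫ x : ℝ in (-(N * Real.pi))..(N * Real.pi), I * N * F (x / N) := by
    apply intervalIntegral.integral_congr_ae
    filter_upwards [MeasureTheory.Measure.ae_ne MeasureTheory.volume (0 : ℝ),
      MeasureTheory.Measure.ae_ne MeasureTheory.volume (N * Real.pi)] with x hx0 hxr hx
    rw [Set.uIoc_of_le hNpi] at hx
    exact cylSlit_sub_self hN hδ hδ1 hy ⟨hx.1, lt_of_le_of_ne hx.2 hxr⟩ hx0
  have hper : Function.Periodic F (2 * Real.pi) := fun θ => by
    simp only [hF, periodic_circleMap 0 R θ]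
  have hshift : ∫ θ in (-Real.pi)..Real.pi, F θ = ∫ θ in (0 : ℝ)..(2 * Real.pi), F θ := by
    have := hper.intervalIntegral_add_eq (-Real.pi) 0
    rwa [zero_add, show -Real.pi + 2 * Real.pi = Real.pi by ring] at this
  have havg := circleAverage_log_slitQuot hδ hδ1 (Real.exp_pos (-y / N))
    (Real.exp_lt_one_iff.2 (div_neg_of_neg_of_pos (by linarith) hN))
  rw [Real.circleAverage_def, inv_smul_eq_iff₀ (by positivity)] at havg
  rw [hcongr, intervalIntegral.integral_const_mul, intervalIntegral.integral_comp_div _ hN.ne',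
    neg_div, mul_div_cancel_left₀ _ hN.ne', hshift, havg]
  simp only [real_smul]
  push_cast
  ring
end

section
/- Fix a real N>0 and 0<δ<1. The boundary limit of the cylindrical slit map at the base point of the slit is lim_{t→0⁺} S^{N,δ}(it) = iN·log((1+δ)/(1−δ)); consequently the slit attached by S^{N,δ} has length λ(δ) = N·log((1+δ)/(1−δ)), and for λ>0 and δ = δ(N,λ) = 1 − 2/(1+e^{λ/N}) this limit equals exactly iλ. (Determination of the scaling parameter δ(N,λ) by following the image of the point 0.) -/
open Complex Filter

theorem fN_mul_I (N t : ℝ) : fN N (t * Complex.I) = (Real.exp (t / N) : ℝ) := by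
  unfold fN
  rw [Complex.ofReal_exp, Complex.ofReal_div,
    show -Complex.I * (t * Complex.I) = (t : ℂ) by linear_combination (-(t : ℂ)) * Complex.I_mul_I]

theorem gMap_ofReal (x : ℝ) : gMap x = Complex.I * ((x - 1) / (x + 1) : ℝ) := by
  unfold gMap
  push_cast
  ring

theorem gInv_I_mul (s : ℝ) : gInv (Complex.I * s) = ((1 + s) / (1 - s) : ℝ) := by
  unfold gInv
  rw [show Complex.I + Complex.I * s = Complex.I * (1 + s) by ring,
    show Complex.I - Complex.I * s = Complex.I * (1 - s) by ring,
    mul_div_mul_left _ _ Complex.I_ne_zero]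
  push_cast
  rfl

theorem phiSlit_I_mul {δ y : ℝ} (hδ : δ ^ 2 ≤ 1) (hy : 0 < y) :
    phiSlit δ (Complex.I * y) = Complex.I * (√(y ^ 2 * (1 - δ ^ 2) + δ ^ 2) : ℝ) := by
  have ha : 0 ≤ 1 - δ ^ 2 + δ ^ 2 / y ^ 2 :=
    add_nonneg (sub_nonneg.2 hδ) (by positivity)
  have hsq : y ^ 2 * (1 - δ ^ 2) + δ ^ 2 = y ^ 2 * (1 - δ ^ 2 + δ ^ 2 / y ^ 2) := by
    field_simp
  have harg : (1 : ℂ) - (δ : ℂ) ^ 2 - (δ : ℂ) ^ 2 / (Complex.I * y) ^ 2 =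
      (1 - δ ^ 2 + δ ^ 2 / y ^ 2 : ℝ) := by
    rw [mul_pow, Complex.I_sq]
    push_cast
    ring
  unfold phiSlit
  rw [harg, hsq, Real.sqrt_mul (sq_nonneg y), Real.sqrt_sq hy.le, Real.sqrt_eq_rpow,
    Complex.ofReal_mul, Complex.ofReal_cpow ha]
  push_cast
  ring

/-- On the imaginary axis, `s` is the height of the image point of the half-plane slit map. -/
theorem cylSlit_mul_I {N δ t : ℝ} (hN : 0 < N) (hδ : δ ^ 2 ≤ 1) (ht : 0 < t) :
    cylSlit N δ (t * Complex.I) =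
      let s := √(((Real.exp (t / N) - 1) / (Real.exp (t / N) + 1)) ^ 2 * (1 - δ ^ 2) + δ ^ 2)
      Complex.I * N * Complex.log ((1 + s) / (1 - s) : ℝ) := by
  have hy : 0 < (Real.exp (t / N) - 1) / (Real.exp (t / N) + 1) :=
    div_pos (sub_pos.2 (Real.one_lt_exp_iff.2 (div_pos ht hN))) (by positivity)
  rw [cylSlit, fN_mul_I, gMap_ofReal, phiSlit_I_mul hδ hy, gInv_I_mul, fNinv]

theorem mul_log_deltaN {N : ℝ} (hN : N ≠ 0) (lam : ℝ) :
    N * Real.log ((1 + deltaN N lam) / (1 - deltaN N lam)) = lam := by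
  have hratio : (1 + deltaN N lam) / (1 - deltaN N lam) = Real.exp (lam / N) := by
    have hpos : 1 + Real.exp (lam / N) ≠ 0 := by positivity
    unfold deltaN
    field_simp
    ring
  rw [hratio, Real.log_exp, mul_div_cancel₀ _ hN]

/-- The boundary limit of the cylindrical slit map at the base point of the slit:
`lim_{t→0⁺} S^{N,δ}(it) = iN log((1+δ)/(1-δ))`; and for `δ = δ(N,λ)`,
the slit length `N log((1+δ)/(1-δ))` equals exactly `λ`. -/
theorem cylSlit_slit_length (N δ : ℝ) (hN : 0 < N) (hδ : 0 < δ) (hδ1 : δ < 1) :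
    Tendsto (fun t : ℝ => cylSlit N δ (t * Complex.I)) (nhdsWithin 0 (Set.Ioi 0))
      (nhds (Complex.I * N * Real.log ((1 + δ) / (1 - δ)))) ∧
    ∀ lam : ℝ, 0 < lam →
      N * Real.log ((1 + deltaN N lam) / (1 - deltaN N lam)) = lam := by
  refine ⟨?_, fun lam _ => mul_log_deltaN hN.ne' lam⟩
  have hδsq : δ ^ 2 ≤ 1 := pow_le_one₀ hδ.le hδ1.le
  have hpos : 0 < (1 + δ) / (1 - δ) := div_pos (by linarith) (sub_pos.2 hδ1)
  let s : ℝ → ℝ := fun t =>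
    √(((Real.exp (t / N) - 1) / (Real.exp (t / N) + 1)) ^ 2 * (1 - δ ^ 2) + δ ^ 2)
  have hs0 : s 0 = δ := by simp [s, Real.sqrt_sq hδ.le]
  have hs : Tendsto s (nhds 0) (nhds δ) := by
    have hcont : Continuous s := by
      have hne : ∀ t : ℝ, Real.exp (t / N) + 1 ≠ 0 := fun t => by positivity
      fun_prop (disch := exact hne _)
    simpa only [hs0] using hcont.tendsto 0
  have hratio : Tendsto (fun t => (1 + s t) / (1 - s t)) (nhds 0) (nhds ((1 + δ) / (1 - δ))) :=
    (hs.const_add 1).div (hs.const_sub 1) (sub_pos.2 hδ1).ne'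
  have hlim : Tendsto (fun t => Complex.I * N * Complex.log ((1 + s t) / (1 - s t) : ℝ)) (nhds 0)
      (nhds (Complex.I * N * Real.log ((1 + δ) / (1 - δ)))) := by
    rw [Complex.ofReal_log hpos.le]
    exact ((Complex.continuous_ofReal.continuousAt.tendsto.comp hratio).clog
      (Complex.ofReal_mem_slitPlane.2 hpos)).const_mul _
  refine (hlim.mono_left nhdsWithin_le_nhds).congr' ?_
  filter_upwards [self_mem_nhdsWithin] with t ht
  exact (cylSlit_mul_I hN hδsq ht).symm
end
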